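/- Let n ≥ 1, t ≥ 1, let w = (w₁,…,w_n) be a probability vector, and let i^(1),…,i^(t) be i.i.d. samples from the categorical distribution on {1,…,n} with parameter w. Let s ⊆ {1,…,n} be a set of users with |s| ≥ 2 and w̄_s = Σ_{i∈s} w_i > 0. Let c_i = #{τ ≤ t : i^(τ) = i} and c_s = Σ_{i∈s} c_i, and for i ∈ s define the empirical within-group frequency r_i = c_i/c_s if c_s > 0 and r_i = 0 otherwise. Then E[ Σ_{i∈s} | r_i − w_i/w̄_s | ] ≤ √( 2(|s| − 1) / (w̄_s t) ). -/

import Mathlib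

/-- `c_i`: the number of time steps `τ ≤ t` at which user `i` was sampled, given the
history `h = (i^{(1)}, …, i^{(t)})`. -/
def usercount {n t : ℕ} (h : Fin t → Fin n) (i : Fin n) : ℕ :=
  (Finset.univ.filter (fun τ => h τ = i)).card

/-- `c_s = Σ_{i ∈ s} c_i`. -/
def groupcount {n t : ℕ} (h : Fin t → Fin n) (s : Finset (Fin n)) : ℕ :=
  ∑ i ∈ s, usercount h i

open Finset

/-- Expectation over `t` independent draws with weights `w`. -/
noncomputable def drawExpect {n : ℕ} (w : Fin n → ℝ) (t : ℕ) (F : (Fin t → Fin n) → ℝ) : ℝ :=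
  ∑ h : Fin t → Fin n, (∏ τ, w (h τ)) * F h

section drawExpect

variable {n t : ℕ} {w : Fin n → ℝ}

theorem drawExpect_zero_draws (F : (Fin 0 → Fin n) → ℝ) : drawExpect w 0 F = F Fin.elim0 := by
  simp only [drawExpect, univ_unique, sum_singleton, univ_eq_empty, prod_empty, one_mul]
  congr 1

theorem drawExpect_succ (F : (Fin (t + 1) → Fin n) → ℝ) :
    drawExpect w (t + 1) F = ∑ x, w x * drawExpect w t (fun h => F (Fin.cons x h)) := by
  unfold drawExpect
  rw [← (Fin.consEquiv (fun _ : Fin (t + 1) => Fin n)).sum_comp, Fintype.sum_prod_type]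
  refine sum_congr rfl fun x _ => ?_
  rw [mul_sum]
  refine sum_congr rfl fun h _ => ?_
  simp [Fin.consEquiv, Fin.prod_univ_succ, mul_assoc]

theorem drawExpect_add (F G : (Fin t → Fin n) → ℝ) :
    drawExpect w t (fun h => F h + G h) = drawExpect w t F + drawExpect w t G := by
  simp [drawExpect, mul_add, sum_add_distrib]

theorem drawExpect_const_mul (a : ℝ) (F : (Fin t → Fin n) → ℝ) :
    drawExpect w t (fun h => a * F h) = a * drawExpect w t F := by
  simp [drawExpect, mul_sum, mul_left_comm]

theorem drawExpect_sum {ι : Type*} (s : Finset ι) (F : ι → (Fin t → Fin n) → ℝ) :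
    drawExpect w t (fun h => ∑ i ∈ s, F i h) = ∑ i ∈ s, drawExpect w t (F i) := by
  simp only [drawExpect, mul_sum]
  exact sum_comm

theorem drawExpect_mono (hw : ∀ i, 0 ≤ w i) {F G : (Fin t → Fin n) → ℝ} (hFG : ∀ h, F h ≤ G h) :
    drawExpect w t F ≤ drawExpect w t G :=
  sum_le_sum fun h _ => mul_le_mul_of_nonneg_left (hFG h) (prod_nonneg fun _ _ => hw _)

theorem drawExpect_one (hw : ∑ i, w i = 1) : drawExpect w t (fun _ => 1) = 1 := by
  induction t with
  | zero => exact drawExpect_zero_draws _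
  | succ t ih => simp [drawExpect_succ, ih, hw]

theorem drawExpect_sq_le (hw0 : ∀ i, 0 ≤ w i) (hw1 : ∑ i, w i = 1) {F : (Fin t → Fin n) → ℝ}
    (hF : ∀ h, 0 ≤ F h) : drawExpect w t F ^ 2 ≤ drawExpect w t (fun h => F h ^ 2) :=
  Real.pow_arith_mean_le_arith_mean_pow univ (fun h : Fin t → Fin n => ∏ τ, w (h τ)) F
    (fun _ _ => prod_nonneg fun _ _ => hw0 _)
    (by simpa [drawExpect] using drawExpect_one (t := t) hw1) (fun h _ => hF h) 2

end drawExpect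

section counts

variable {n t : ℕ}

theorem usercount_cons (x : Fin n) (h : Fin t → Fin n) (i : Fin n) :
    usercount (Fin.cons x h : Fin (t + 1) → Fin n) i = (if x = i then 1 else 0) + usercount h i := by
  simp only [usercount, card_filter, Fin.sum_univ_succ, Fin.cons_zero, Fin.cons_succ]

theorem groupcount_cons (x : Fin n) (h : Fin t → Fin n) (s : Finset (Fin n)) :
    groupcount (Fin.cons x h : Fin (t + 1) → Fin n) s
      = (if x ∈ s then 1 else 0) + groupcount h s := by
  simp [groupcount, usercount_cons, sum_add_distrib]

theorem usercount_elim0 (i : Fin n) : usercount (Fin.elim0 : Fin 0 → Fin n) i = 0 := by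
  simp [usercount]

theorem groupcount_elim0 (s : Finset (Fin n)) :
    groupcount (Fin.elim0 : Fin 0 → Fin n) s = 0 := by
  simp [groupcount, usercount_elim0]

end counts

section moments

variable {n : ℕ} {w : Fin n → ℝ} {s : Finset (Fin n)} {i : Fin n} {q : ℝ}

/-- The size-biasing identity for the binomial variable `groupcount`. -/
theorem drawExpect_groupcount_mul (t : ℕ) (g : ℕ → ℝ) :
    drawExpect w (t + 1) (fun h => (groupcount h s : ℝ) * g (groupcount h s))
      = (t + 1) * (∑ j ∈ s, w j) * drawExpect w t (fun h => g (1 + groupcount h s)) := by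
  have sum_mem (a : ℝ) : ∑ x, w x * (if x ∈ s then a else 0) = (∑ j ∈ s, w j) * a := by
    simp [sum_mul]
  induction t generalizing g with
  | zero =>
    simp only [drawExpect_succ, drawExpect_zero_draws, groupcount_cons, groupcount_elim0, add_zero]
    rw [Nat.cast_zero, zero_add, one_mul, ← sum_mem]
    refine sum_congr rfl fun x _ => ?_
    split_ifs <;> simp
  | succ t ih =>
    rw [drawExpect_succ]
    have key (x : Fin n) : w x * drawExpect w (t + 1) (fun h =>
          (groupcount (Fin.cons x h : Fin (t + 1 + 1) → Fin n) s : ℝ)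
            * g (groupcount (Fin.cons x h : Fin (t + 1 + 1) → Fin n) s))
        = w x * (if x ∈ s then drawExpect w (t + 1) (fun h => g (1 + groupcount h s)) else 0)
          + (t + 1) * (∑ j ∈ s, w j) * (w x * drawExpect w t (fun h =>
            g (1 + groupcount (Fin.cons x h : Fin (t + 1) → Fin n) s))) := by
      simp only [groupcount_cons]
      have := ih (fun m => g ((if x ∈ s then 1 else 0) + m))
      simp only [Nat.cast_add, add_mul, drawExpect_add, drawExpect_const_mul, this]
      simp only [add_left_comm 1]
      split_ifs <;> simp <;> ring
    rw [sum_congr rfl fun x _ => key x, sum_add_distrib, sum_mem, ← mul_sum,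
      ← drawExpect_succ (F := fun h => g (1 + groupcount h s))]
    push_cast
    ring

/-- Increment of `usercount - q * groupcount` caused by drawing `x`. -/
def centeredIncrement (s : Finset (Fin n)) (i : Fin n) (q : ℝ) (x : Fin n) : ℝ :=
  (if x = i then 1 else 0) - q * (if x ∈ s then 1 else 0)

theorem centered_cons {t : ℕ} (x : Fin n) (h : Fin t → Fin n) :
    (usercount (Fin.cons x h : Fin (t + 1) → Fin n) i : ℝ)
        - q * groupcount (Fin.cons x h : Fin (t + 1) → Fin n) s
      = centeredIncrement s i q x + (usercount h i - q * groupcount h s) := by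
  simp only [usercount_cons, groupcount_cons, centeredIncrement]
  push_cast
  ring

theorem centeredIncrement_mul (hi : i ∈ s) (x : Fin n) (G : ℕ → ℝ) :
    centeredIncrement s i q x * G (if x ∈ s then 1 else 0)
      = centeredIncrement s i q x * G 1 := by
  by_cases hx : x ∈ s
  · simp [hx]
  · have : x ≠ i := fun h => hx (h ▸ hi)
    simp [centeredIncrement, hx, this]

theorem sum_mul_centeredIncrement (hq : w i = q * ∑ j ∈ s, w j) :
    ∑ x, w x * centeredIncrement s i q x = 0 := by
  have h : ∀ x, w x * centeredIncrement s i q x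
      = (if x = i then w x else 0) - q * (if x ∈ s then w x else 0) := by
    intro x
    unfold centeredIncrement
    split_ifs <;> ring
  simp [h, ← mul_sum, hq]

theorem sum_mul_centeredIncrement_sq (hi : i ∈ s) (hq : w i = q * ∑ j ∈ s, w j) :
    ∑ x, w x * centeredIncrement s i q x ^ 2 = q * (1 - q) * ∑ j ∈ s, w j := by
  have h : ∀ x, w x * centeredIncrement s i q x ^ 2
      = (1 - 2 * q) * (if x = i then w x else 0) + q ^ 2 * (if x ∈ s then w x else 0) := by
    intro x
    unfold centeredIncrement
    by_cases hx : x = i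
    · subst hx
      simp only [hi, if_true]
      ring
    · simp only [hx, if_false]
      split_ifs <;> ring
  simp only [h, sum_add_distrib, ← mul_sum, sum_ite_eq', mem_univ, if_true, sum_ite_mem,
    univ_inter, hq]
  ring

theorem drawExpect_centered_mul (hi : i ∈ s) (hq : w i = q * ∑ j ∈ s, w j) (t : ℕ) (g : ℕ → ℝ) :
    drawExpect w t (fun h => ((usercount h i : ℝ) - q * groupcount h s) * g (groupcount h s)) = 0 := by
  induction t generalizing g with
  | zero => simp [drawExpect_zero_draws, usercount_elim0, groupcount_elim0]
  | succ t ih =>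
    simp only [drawExpect_succ, centered_cons]
    simp only [groupcount_cons, add_mul, drawExpect_add, drawExpect_const_mul]
    have key (x : Fin n) := centeredIncrement_mul (q := q) hi x
      (fun b => drawExpect w t (fun h => g (b + groupcount h s)))
    have tail (x : Fin n) := ih (fun m => g ((if x ∈ s then 1 else 0) + m))
    simp only [key, tail, add_zero, ← mul_assoc, ← sum_mul,
      sum_mul_centeredIncrement hq, zero_mul]

theorem drawExpect_centered_sq_mul (hi : i ∈ s) (hq : w i = q * ∑ j ∈ s, w j) (t : ℕ) (g : ℕ → ℝ) :
    drawExpect w t (fun h => ((usercount h i : ℝ) - q * groupcount h s) ^ 2 * g (groupcount h s))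
      = q * (1 - q) * drawExpect w t (fun h => (groupcount h s : ℝ) * g (groupcount h s)) := by
  induction t generalizing g with
  | zero => simp [drawExpect_zero_draws, usercount_elim0, groupcount_elim0]
  | succ t ih =>
    have left (x : Fin n) : drawExpect w t (fun h =>
          ((usercount (Fin.cons x h : Fin (t + 1) → Fin n) i : ℝ)
            - q * groupcount (Fin.cons x h : Fin (t + 1) → Fin n) s) ^ 2
            * g (groupcount (Fin.cons x h : Fin (t + 1) → Fin n) s))
        = centeredIncrement s i q x ^ 2 * drawExpect w t (fun h => g (1 + groupcount h s))
          + q * (1 - q) * drawExpect w t (fun h => (groupcount h s : ℝ)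
            * g ((if x ∈ s then 1 else 0) + groupcount h s)) := by
      have hsq := centeredIncrement_mul (q := q) hi x
        (fun b => drawExpect w t (fun h => g (b + groupcount h s)))
      have hz := drawExpect_centered_mul hi hq t (fun m => g ((if x ∈ s then 1 else 0) + m))
      have hih := ih (fun m => g ((if x ∈ s then 1 else 0) + m))
      simp only [centered_cons]
      simp only [groupcount_cons, add_sq (centeredIncrement s i q x), add_mul, drawExpect_add,
        mul_assoc, drawExpect_const_mul] at hz hih hsq ⊢
      rw [hz, hih, pow_two, mul_assoc, hsq]
      ring
    have right (x : Fin n) : drawExpect w t (fun h =>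
          (groupcount (Fin.cons x h : Fin (t + 1) → Fin n) s : ℝ)
            * g (groupcount (Fin.cons x h : Fin (t + 1) → Fin n) s))
        = (if x ∈ s then 1 else 0) * drawExpect w t (fun h => g (1 + groupcount h s))
          + drawExpect w t (fun h => (groupcount h s : ℝ)
            * g ((if x ∈ s then 1 else 0) + groupcount h s)) := by
      simp only [groupcount_cons, Nat.cast_add, add_mul, drawExpect_add, drawExpect_const_mul]
      split_ifs <;> simp
    simp only [drawExpect_succ, left, right, mul_add, sum_add_distrib, ← mul_assoc, ← sum_mul,
      sum_mul_centeredIncrement_sq hi hq]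
    congr 1
    · simp
    · simp only [mul_sum]
      exact sum_congr rfl fun x _ => by ring

theorem drawExpect_inv_groupcount_succ_le (hw0 : ∀ i, 0 ≤ w i) (hw1 : ∑ i, w i = 1)
    (hs : 0 < ∑ j ∈ s, w j) (t : ℕ) :
    drawExpect w t (fun h => ((1 + groupcount h s : ℕ) : ℝ)⁻¹) ≤ ((t + 1) * ∑ j ∈ s, w j)⁻¹ := by
  have h := drawExpect_groupcount_mul (w := w) (s := s) t (fun m => (m : ℝ)⁻¹)
  have hle : drawExpect w (t + 1) (fun h => (groupcount h s : ℝ) * (groupcount h s : ℝ)⁻¹) ≤ 1 := by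
    rw [← drawExpect_one (t := t + 1) hw1]
    exact drawExpect_mono hw0 fun h => mul_inv_le_one
  rw [h] at hle
  rw [← one_div, le_div_iff₀ (by positivity), mul_comm]
  exact hle

end moments

theorem card_mul_sum_mul_one_sub_le {ι : Type*} {s : Finset ι} {q : ι → ℝ}
    (hq : ∑ i ∈ s, q i = 1) : (s.card : ℝ) * ∑ i ∈ s, q i * (1 - q i) ≤ s.card - 1 := by
  have h := sq_sum_le_card_mul_sum_sq (s := s) (f := q)
  have e : ∑ i ∈ s, q i * (1 - q i) = 1 - ∑ i ∈ s, q i ^ 2 := by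
    simp [mul_sub, sum_sub_distrib, hq, pow_two]
  rw [hq] at h
  rw [e]
  linarith

/-- Pointwise bound on the squared within-group deviation. -/
theorem sq_sum_abs_frequency_sub_le {n t : ℕ} {s : Finset (Fin n)} {q : Fin n → ℝ}
    (hs : 2 ≤ s.card) (hq0 : ∀ i, 0 ≤ q i) (hq1 : ∑ i ∈ s, q i = 1) (h : Fin t → Fin n) :
    (∑ i ∈ s, |(if 0 < groupcount h s then (usercount h i : ℝ) / (groupcount h s : ℝ) else 0)
        - q i|) ^ 2
      ≤ s.card * ∑ i ∈ s, ((usercount h i : ℝ) - q i * groupcount h s) ^ 2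
          * ((groupcount h s : ℝ) ^ 2)⁻¹
        + (s.card - 1) * (if groupcount h s = 0 then 1 else 0) := by
  rcases Nat.eq_zero_or_pos (groupcount h s) with h0 | h0
  · have : (2 : ℝ) ≤ s.card := by exact_mod_cast hs
    simp [h0, abs_of_nonneg (hq0 _), hq1]
    linarith
  · simp only [h0, h0.ne', if_true, if_false, mul_zero, add_zero]
    refine sq_sum_le_card_mul_sum_sq.trans_eq ?_
    congr 1
    refine sum_congr rfl fun i _ => ?_
    have : (groupcount h s : ℝ) ≠ 0 := by exact_mod_cast h0.ne'
    rw [sq_abs]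
    field_simp

theorem mul_inv_sq_add_ite_le (m : ℕ) :
    (m : ℝ) * ((m : ℝ) ^ 2)⁻¹ + (if m = 0 then 1 else 0) ≤ 2 * ((1 + m : ℕ) : ℝ)⁻¹ := by
  rcases Nat.eq_zero_or_pos m with rfl | hm
  · simp
  · have h1 : (1 : ℝ) ≤ m := by exact_mod_cast hm
    have h2 : (m : ℝ) * ((m : ℝ) ^ 2)⁻¹ = 1 / m := by field_simp
    rw [if_neg hm.ne', add_zero, h2, ← div_eq_mul_inv, div_le_div_iff₀ (by positivity) (by positivity)]
    push_cast
    linarith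

/-- Deviation of the empirical within-group frequencies (Lemma 4 of the paper):
with `i^{(1)},…,i^{(t)}` i.i.d. categorical with parameter `w` (histories
`h : Fin t → Fin n`, expectations written as `∑ h, (∏ τ, w (h τ)) * F h`),
`E[Σ_{i ∈ s} |r_i - w_i/w̄_s|] ≤ √(2(|s|-1)/(w̄_s t))`, where `r_i = c_i/c_s` if
`c_s > 0` and `r_i = 0` otherwise. -/
theorem group_frequency_deviation
    (n t : ℕ) (hn : 1 ≤ n) (ht : 1 ≤ t)
    (w : Fin n → ℝ) (hw0 : ∀ i, 0 ≤ w i) (hw1 : ∑ i, w i = 1)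
    (s : Finset (Fin n)) (hs : 2 ≤ s.card)
    (hwbar : 0 < ∑ i ∈ s, w i) :
    ∑ h : Fin t → Fin n, (∏ τ, w (h τ)) *
      (∑ i ∈ s,
        |(if 0 < groupcount h s then (usercount h i : ℝ) / (groupcount h s : ℝ) else 0)
          - w i / (∑ i' ∈ s, w i')|)
      ≤ Real.sqrt (2 * ((s.card : ℝ) - 1) / ((∑ i ∈ s, w i) * (t : ℝ))) := by
  set p := ∑ i ∈ s, w i with hp
  set q : Fin n → ℝ := fun i => w i / p with hqdef
  have hq0 : ∀ i, 0 ≤ q i := fun i => div_nonneg (hw0 i) hwbar.le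
  have hq1 : ∑ i ∈ s, q i = 1 := by rw [← sum_div, ← hp, div_self hwbar.ne']
  have hq : ∀ i, w i = q i * ∑ j ∈ s, w j := fun i => (div_mul_cancel₀ _ hwbar.ne').symm
  have hk : (0 : ℝ) ≤ s.card - 1 := by
    have : (2 : ℝ) ≤ s.card := by exact_mod_cast hs
    linarith
  have ht0 : (0 : ℝ) < t := by exact_mod_cast ht
  apply Real.le_sqrt_of_sq_le
  have hsecond := drawExpect_mono (t := t) hw0 (sq_sum_abs_frequency_sub_le hs hq0 hq1)
  rw [drawExpect_add, drawExpect_const_mul, drawExpect_const_mul, drawExpect_sum,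
    sum_congr rfl fun i hi =>
      drawExpect_centered_sq_mul hi (hq i) t (fun m => ((m : ℝ) ^ 2)⁻¹), ← sum_mul,
    ← mul_assoc] at hsecond
  have hnn : 0 ≤ drawExpect w t (fun h => (groupcount h s : ℝ) * ((groupcount h s : ℝ) ^ 2)⁻¹) :=
    sum_nonneg fun h _ => mul_nonneg (prod_nonneg fun _ _ => hw0 _) (by positivity)
  have hcount := drawExpect_mono (t := t) hw0 (fun h => mul_inv_sq_add_ite_le (groupcount h s))
  rw [drawExpect_add, drawExpect_const_mul] at hcount
  calc _ ≤ _ := drawExpect_sq_le hw0 hw1 fun h => sum_nonneg fun i _ => abs_nonneg _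
    _ ≤ _ := hsecond
    _ ≤ _ := add_le_add_left (mul_le_mul_of_nonneg_right (card_mul_sum_mul_one_sub_le hq1) hnn) _
    _ = _ := (mul_add _ _ _).symm
    _ ≤ (s.card - 1) * (2 * ((t + 1) * p)⁻¹) := by
      refine mul_le_mul_of_nonneg_left (hcount.trans ?_) hk
      exact mul_le_mul_of_nonneg_left (drawExpect_inv_groupcount_succ_le hw0 hw1 hwbar t) (by norm_num)
    _ ≤ (s.card - 1) * (2 * (p * t)⁻¹) := by
      have : p * t ≤ (t + 1) * p := by linarith
      gcongr
    _ = _ := by ring
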